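/- Let X be any real-valued random variable and let Y be a real-valued random variable with probability density function p bounded above by a constant A > 0. Then, for any m ≥ 1, d_K(X,Y) ≤ 2 (A^m M_m d_m(X,Y))^{1/(m+1)} + M_m d_m(X,Y). -/

import Mathlib

open MeasureTheory ProbabilityTheory Real
open scoped NNReal

/-- `M_m = 2^(m-2) (m-1)!` -/
noncomputable def Mc (m : ℕ) : ℝ := (2 : ℝ) ^ ((m : ℤ) - 2) * (Nat.factorial (m - 1) : ℝ)

/-- `N_m = 2^m M_m` -/
noncomputable def Nc (m : ℕ) : ℝ := 2 ^ m * Mc m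

/-- The test functions for the smooth Wasserstein distance `d_m`: `h^(m-1)` is Lipschitz
(with Lipschitz constant, i.e. `‖h^(m)‖`, at most 1) and `‖h^(j)‖ ≤ 1` for `0 ≤ j ≤ m-1`. -/
def testFun (m : ℕ) (h : ℝ → ℝ) : Prop :=
  ContDiff ℝ (↑(m - 1)) h ∧
  (∀ j ≤ m - 1, ∀ x : ℝ, |iteratedDeriv j h x| ≤ 1) ∧
  LipschitzWith 1 (iteratedDeriv (m - 1) h)

/-- The smooth Wasserstein distance `d_m` between two distributions on `ℝ`. -/
noncomputable def dSm (m : ℕ) (μ ν : Measure ℝ) : ℝ :=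
  ⨆ h : {h : ℝ → ℝ // testFun m h}, |(∫ x, h.1 x ∂μ) - ∫ x, h.1 x ∂ν|

/-- The Kolmogorov distance between two distributions on `ℝ`. -/
noncomputable def dKol (μ ν : Measure ℝ) : ℝ :=
  ⨆ z : ℝ, |(μ (Set.Iic z)).toReal - (ν (Set.Iic z)).toReal|

section ChebyshevWeights

open Polynomial Polynomial.Chebyshev

/-- Half the ratio of the barycentric weight of an endpoint to that of an interior Chebyshev
extremal node. -/
noncomputable def endpointFactor (n i : ℕ) : ℝ := if i = 0 ∨ i = n then 1 / 2 else 1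

lemma eval_U_node (k i : ℕ) :
    (node (k + 1) i ^ 2 - 1) * (U ℝ k).eval (node (k + 1) i) = 0 := by
  have h := U_real_cos (i * π / ((k + 1 : ℕ) : ℝ)) (k : ℤ)
  have h1 : ((k : ℤ) + 1 : ℝ) * (i * π / ((k + 1 : ℕ) : ℝ)) = i * π := by
    push_cast; field_simp
  rw [h1, sin_nat_mul_pi] at h
  have h2 : node (k + 1) i ^ 2 - 1 = - sin (i * π / ((k + 1 : ℕ) : ℝ)) ^ 2 := by
    rw [sin_sq, node]; ring
  rw [h2, node]
  linear_combination (-sin (i * π / ((k + 1 : ℕ) : ℝ))) * h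

lemma node_injOn (n : ℕ) : Set.InjOn (node n) (Finset.range (n + 1)) :=
  (strictAntiOn_node n).injOn

lemma nodal_node (k : ℕ) :
    C (2 ^ k) * Lagrange.nodal (Finset.range (k + 2)) (node (k + 1)) = (X ^ 2 - 1) * U ℝ k := by
  have hX : (X ^ 2 - 1 : ℝ[X]) = X ^ 2 - C 1 := by simp
  have hlX : (X ^ 2 - 1 : ℝ[X]).leadingCoeff = 1 := by
    rw [hX]; exact leadingCoeff_X_pow_sub_C (by norm_num)
  have hdX : (X ^ 2 - 1 : ℝ[X]).degree = 2 := by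
    rw [hX]; exact degree_X_pow_sub_C (by norm_num) _
  have hd : (C (2 ^ k) * Lagrange.nodal (Finset.range (k + 2)) (node (k + 1))).degree
      = ((k + 2 : ℕ) : WithBot ℕ) := by
    rw [degree_mul, degree_C (by positivity), Lagrange.degree_nodal, Finset.card_range, zero_add]
  refine eq_of_degree_le_of_eval_index_eq _ (node_injOn (k + 1)) ?_ ?_ ?_ ?_
  · rw [hd, Finset.card_range]
  · rw [hd, degree_mul, hdX, degree_U_natCast, add_comm]; push_cast; rfl
  · rw [leadingCoeff_mul, leadingCoeff_mul, hlX, leadingCoeff_C, leadingCoeff_U_natCast,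
      Lagrange.nodal_monic.leadingCoeff]
    ring
  · intro i hi
    rw [eval_mul, Lagrange.eval_nodal_at_node hi, mul_zero, eval_mul]
    simpa using (eval_U_node k i).symm

lemma node_mul_eval_U {k i : ℕ} (hi : i ≤ k + 1) :
    node (k + 1) i * (U ℝ k).eval (node (k + 1) i)
      = if i = 0 ∨ i = k + 1 then (-1 : ℝ) ^ i * (k + 1) else 0 := by
  split_ifs with h
  · rcases h with rfl | rfl
    · rw [node_eq_one, U_eval_one]; simp
    · rw [node_eq_neg_one (by omega), U_eval_neg_one, Int.cast_negOnePow]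
      push_cast
      rw [zpow_natCast]; ring
  · push Not at h
    have h1 : node (k + 1) i < 1 := by
      rw [← node_eq_one (n := k + 1)]; exact node_lt hi (by omega)
    have h2 : -1 < node (k + 1) i := by
      rw [← node_eq_neg_one (n := k + 1) (by omega)]; exact node_lt le_rfl (by omega)
    rcases mul_eq_zero.1 (eval_U_node k i) with h3 | h3
    · nlinarith
    · rw [h3, mul_zero]

lemma prod_node_sub_node {k i : ℕ} (hi : i ≤ k + 1) :
    1 / ∏ j ∈ (Finset.range (k + 2)).erase i, (node (k + 1) i - node (k + 1) j)
      = 2 ^ k / (k + 1) * ((-1) ^ i * endpointFactor (k + 1) i) := by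
  have hi' : i ∈ Finset.range (k + 2) := Finset.mem_range.2 (by omega)
  rw [← Lagrange.eval_nodal, ← Lagrange.eval_nodal_derivative_eval_node_eq hi']
  have h1 := congr_arg (fun P => (derivative P).eval (node (k + 1) i)) (nodal_node k)
  have h2 := congr_arg (fun P => P.eval (node (k + 1) i)) (add_one_mul_T_eq_poly_in_U (R := ℝ) k)
  have h3 := eval_T_real_node (n := k + 1) (i := i) (by simpa using hi)
  have h4 := node_mul_eval_U hi
  simp only [derivative_mul, derivative_C, zero_mul, zero_add, eval_mul, eval_C, derivative_sub,
    derivative_X_pow, derivative_one, sub_zero, eval_add, eval_sub, eval_pow, eval_X, eval_one,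
    eval_natCast, Nat.cast_ofNat, Int.cast_natCast] at h1 h2
  push_cast at h3
  rw [h3] at h2
  set N := eval (node (k + 1) i) (derivative (Lagrange.nodal (Finset.range (k + 2)) (node (k + 1))))
  have h5 : 2 ^ k * N = (-1) ^ i * (k + 1) / endpointFactor (k + 1) i := by
    rw [h1]
    have : (-1 : ℝ) ^ i * (k + 1) / endpointFactor (k + 1) i
        = node (k + 1) i * (U ℝ k).eval (node (k + 1) i) + (k + 1) * (-1) ^ i := by
      rw [h4, endpointFactor]; split_ifs <;> ring
    rw [this]; norm_num at h2 ⊢; linear_combination - h2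
  have h6 : endpointFactor (k + 1) i ≠ 0 := by rw [endpointFactor]; split_ifs <;> norm_num
  have h7 : ((-1 : ℝ) ^ i) * (-1) ^ i = 1 := by rw [← mul_pow]; norm_num
  have h8 : N = (-1) ^ i * (k + 1) / endpointFactor (k + 1) i / 2 ^ k := by
    rw [← h5]; field_simp
  rw [h8]
  have h9 : ((-1 : ℝ) ^ i) ≠ 0 := by positivity
  field_simp
  linear_combination -h7

/-- The divided difference at the Chebyshev extremal nodes of order `k + 1`. -/
noncomputable def chebDiff (k : ℕ) (f : ℝ → ℝ) : ℝ :=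
  2 ^ k / (k + 1) *
    ∑ i ∈ Finset.range (k + 2), (-1) ^ i * endpointFactor (k + 1) i * f (node (k + 1) i)

lemma chebDiff_eval {k : ℕ} {P : ℝ[X]} (hP : P.degree ≤ (k + 1 : ℕ)) :
    chebDiff k (fun t => P.eval t) = P.coeff (k + 1) := by
  have h := Lagrange.coeff_eq_sum (node_injOn (k + 1)) (P := P)
    (lt_of_le_of_lt hP (by rw [Finset.card_range]; exact_mod_cast Nat.lt_succ_self _))
  rw [Finset.card_range] at h
  rw [show k + 1 = k + 1 + 1 - 1 from rfl, h, chebDiff, Finset.mul_sum]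
  refine Finset.sum_congr rfl fun i hi => ?_
  rw [div_eq_mul_one_div (eval _ P), prod_node_sub_node (by simpa [Nat.lt_succ_iff] using hi)]
  ring

end ChebyshevWeights

section DerivativeFamilies

lemma iteratedDeriv_of_family {F : ℕ → ℝ → ℝ} {k : ℕ}
    (hF : ∀ j < k, ∀ x, HasDerivAt (F j) (F (j + 1) x) x) {j : ℕ} (hj : j ≤ k) :
    iteratedDeriv j (F 0) = F j := by
  induction j with
  | zero => exact iteratedDeriv_zero
  | succ j ih =>
    rw [iteratedDeriv_succ, ih (by omega)]
    ext x
    exact (hF j (by omega) x).deriv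

lemma contDiff_of_family {F : ℕ → ℝ → ℝ} {k : ℕ}
    (hF : ∀ j < k, ∀ x, HasDerivAt (F j) (F (j + 1) x) x) (hc : Continuous (F k)) :
    ContDiff ℝ k (F 0) := by
  refine contDiff_nat_iff_iteratedDeriv.2 ⟨fun j hj => ?_, fun j hj => ?_⟩
  · rw [iteratedDeriv_of_family hF hj]
    rcases hj.lt_or_eq with h | rfl
    · exact continuous_iff_continuousAt.2 fun x => (hF j h x).continuousAt
    · exact hc
  · rw [iteratedDeriv_of_family hF hj.le]
    exact fun x => (hF j hj x).differentiableAt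

lemma exists_strictMono_zeros_of_family {E : ℕ → ℝ → ℝ} {k : ℕ}
    (hE : ∀ j < k, ∀ x, HasDerivAt (E j) (E (j + 1) x) x) {a b : ℝ} {g : ℕ → ℝ}
    (hg : ∀ i < k + 1, g i < g (i + 1)) (hab : ∀ i < k + 2, g i ∈ Set.Icc a b)
    (h0 : ∀ i < k + 2, E 0 (g i) = 0) {j : ℕ} (hj : j ≤ k) :
    ∃ g' : ℕ → ℝ, (∀ i, i + j < k + 1 → g' i < g' (i + 1)) ∧
      ∀ i, i + j < k + 2 → g' i ∈ Set.Icc a b ∧ E j (g' i) = 0 := by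
  induction j with
  | zero => exact ⟨g, fun i hi => hg i hi, fun i hi => ⟨hab i hi, h0 i hi⟩⟩
  | succ j ih =>
    obtain ⟨u, hu, hz⟩ := ih (by omega)
    have step : ∀ i, ∃ y, i + j < k + 1 → y ∈ Set.Ioo (u i) (u (i + 1)) ∧ E (j + 1) y = 0 := by
      intro i
      by_cases hi : i + j < k + 1
      · obtain ⟨y, hy, hy0⟩ := exists_hasDerivAt_eq_zero (hu i hi)
          (fun x _ => (hE j (by omega) x).continuousAt.continuousWithinAt)
          ((hz i (by omega)).2.trans (hz (i + 1) (by omega)).2.symm)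
          (fun x _ => hE j (by omega) x)
        exact ⟨y, fun _ => ⟨hy, hy0⟩⟩
      · exact ⟨0, fun h => absurd h hi⟩
    choose v hv using step
    refine ⟨v, fun i hi => ?_, fun i hi => ⟨⟨?_, ?_⟩, (hv i (by omega)).2⟩⟩
    · exact (hv i (by omega)).1.2.trans (hv (i + 1) (by omega)).1.1
    · exact (hz i (by omega)).1.1.trans (hv i (by omega)).1.1.le
    · exact (hv i (by omega)).1.2.le.trans (hz (i + 1) (by omega)).1.2

end DerivativeFamilies

section Spline

open Polynomial Polynomial.Chebyshev

lemma eval_iterate_derivative_sub {k : ℕ} {P : ℝ[X]} (hP : P.natDegree ≤ k + 1) (a b : ℝ) :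
    (derivative^[k] P).eval b - (derivative^[k] P).eval a
      = (k + 1).factorial * P.coeff (k + 1) * (b - a) := by
  have hd : (derivative^[k] P).natDegree ≤ 1 :=
    (natDegree_iterate_derivative P k).trans (by omega)
  rw [eq_X_add_C_of_natDegree_le_one hd, coeff_iterate_derivative, add_comm 1 k]
  have : (k + 1).descFactorial k = (k + 1).factorial := by
    have := Nat.factorial_mul_descFactorial (n := k + 1) (k := k) (by omega)
    simpa using this
  rw [this]
  simp
  ring

/-- The mean value theorem for divided differences at the Chebyshev extremal nodes. -/
lemma exists_chebDiff_eq {k : ℕ} {F : ℕ → ℝ → ℝ}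
    (hF : ∀ j < k, ∀ x, HasDerivAt (F j) (F (j + 1) x) x) :
    ∃ a b : ℝ, -1 ≤ a ∧ a < b ∧ b ≤ 1 ∧
      (k + 1).factorial * chebDiff k (F 0) * (b - a) = F k b - F k a := by
  set P := Lagrange.interpolate (Finset.range (k + 2)) (node (k + 1))
    (fun i => F 0 (node (k + 1) i)) with hPdef
  have hPn : ∀ i < k + 2, P.eval (node (k + 1) i) = F 0 (node (k + 1) i) := fun i hi =>
    Lagrange.eval_interpolate_at_node _ (node_injOn (k + 1)) (Finset.mem_range.2 hi)
  have hPd : P.degree ≤ (k + 1 : ℕ) := by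
    have := Lagrange.degree_interpolate_le (fun i => F 0 (node (k + 1) i)) (node_injOn (k + 1))
    rwa [Finset.card_range, Nat.add_sub_cancel] at this
  have hc : chebDiff k (F 0) = P.coeff (k + 1) := by
    rw [← chebDiff_eval hPd, chebDiff, chebDiff]
    congr 1
    exact Finset.sum_congr rfl fun i hi => by rw [hPn i (Finset.mem_range.1 hi)]
  obtain ⟨g, hg, hz⟩ := exists_strictMono_zeros_of_family
    (E := fun j x => F j x - (derivative^[j] P).eval x) (k := k) (a := -1) (b := 1)
    (g := fun i => node (k + 1) (k + 1 - i))
    (fun j hj x => by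
      rw [Function.iterate_succ_apply']
      exact (hF j hj x).sub (Polynomial.hasDerivAt _ x))
    (fun i hi => node_lt (by omega) (by omega))
    (fun i _ => node_mem_Icc)
    (fun i hi => by simp [hPn (k + 1 - i) (by omega)]) le_rfl
  have h0 := hz 0 (by omega)
  have h1 := hz 1 (by omega)
  refine ⟨g 0, g 1, h0.1.1, hg 0 (by omega), h1.1.2, ?_⟩
  rw [hc, ← eval_iterate_derivative_sub (natDegree_le_of_degree_le hPd)]
  linear_combination h0.2 - h1.2

lemma hasDerivAt_posPart_pow (r : ℕ) (x : ℝ) :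
    HasDerivAt (fun t : ℝ => max t 0 ^ (r + 2)) ((r + 2 : ℕ) * max x 0 ^ (r + 1)) x := by
  rcases lt_trichotomy x 0 with hx | rfl | hx
  · rw [max_eq_right hx.le]
    have : (fun t : ℝ => max t 0 ^ (r + 2)) =ᶠ[nhds x] fun _ => 0 := by
      filter_upwards [Iio_mem_nhds hx] with t ht
      rw [max_eq_right (le_of_lt ht)]; simp
    simpa using (hasDerivAt_const x (0 : ℝ)).congr_of_eventuallyEq this
  · have h : HasDerivAt (fun t : ℝ => t ^ (r + 2)) 0 0 := by
      simpa using hasDerivAt_pow (r + 2) (0 : ℝ)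
    rw [hasDerivAt_iff_isLittleO] at h ⊢
    simp only [max_self, ne_eq, Nat.add_eq_zero_iff, OfNat.ofNat_ne_zero, and_false,
      not_false_eq_true, zero_pow, sub_zero, smul_zero, mul_zero, one_ne_zero] at h ⊢
    refine Asymptotics.IsBigO.trans_isLittleO (Asymptotics.isBigO_of_le _ fun t => ?_) h
    rw [norm_pow, norm_pow]
    gcongr
    rw [Real.norm_eq_abs, Real.norm_eq_abs, abs_of_nonneg (le_max_right _ _)]
    exact max_le (le_abs_self _) (abs_nonneg _)
  · rw [max_eq_left hx.le]
    have : (fun t : ℝ => max t 0 ^ (r + 2)) =ᶠ[nhds x] fun t => t ^ (r + 2) := by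
      filter_upwards [Ioi_mem_nhds hx] with t ht
      rw [max_eq_left (le_of_lt ht)]
    simpa using (hasDerivAt_pow (r + 2) x).congr_of_eventuallyEq this

/-- The derivatives of the Chebyshev perfect spline decreasing from `1` at `-1` to `0` at `1`. -/
noncomputable def chebSpline (k j : ℕ) (x : ℝ) : ℝ :=
  (-1) ^ j * (k + 1).descFactorial j * chebDiff k (fun t => max (t - x) 0 ^ (k + 1 - j))

lemma chebSpline_zero (k : ℕ) (x : ℝ) :
    chebSpline k 0 x = chebDiff k (fun t => max (t - x) 0 ^ (k + 1)) := by
  simp [chebSpline]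

lemma hasDerivAt_chebSpline {k j : ℕ} (hj : j < k) (x : ℝ) :
    HasDerivAt (chebSpline k j) (chebSpline k (j + 1) x) x := by
  obtain ⟨r, rfl⟩ : ∃ r, k = j + r + 1 := ⟨k - j - 1, by omega⟩
  have e1 : j + r + 1 + 1 - j = r + 2 := by omega
  have e2 : j + r + 1 + 1 - (j + 1) = r + 1 := by omega
  have hd : ∀ t : ℝ, HasDerivAt (fun x => max (t - x) 0 ^ (r + 2))
      (-((r + 2 : ℕ) * max (t - x) 0 ^ (r + 1))) x := fun t =>
    ((hasDerivAt_posPart_pow r (t - x)).comp x ((hasDerivAt_id x).const_sub t)).congr_deriv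
      (by ring)
  have h := (HasDerivAt.fun_sum (u := Finset.range (j + r + 1 + 2)) fun i _ =>
    (hd (node (j + r + 1 + 1) i)).const_mul
      ((-1) ^ i * endpointFactor (j + r + 1 + 1) i)).const_mul
      ((2 : ℝ) ^ (j + r + 1) / ((j + r + 1 : ℕ) + 1))
  have h2 := h.const_mul ((-1) ^ j * ((j + r + 1 + 1).descFactorial j : ℝ))
  unfold chebSpline chebDiff
  rw [e1, e2]
  refine h2.congr_deriv ?_
  rw [Nat.descFactorial_succ, e1, pow_succ]
  simp only [Finset.mul_sum]
  refine Finset.sum_congr rfl fun i _ => ?_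
  push_cast
  ring

lemma exists_chebSpline_mul_eq (k : ℕ) (x : ℝ) :
    ∃ a b : ℝ, -1 ≤ a ∧ a < b ∧ b ≤ 1 ∧
      chebSpline k 0 x * (b - a) = max (b - x) 0 - max (a - x) 0 := by
  obtain ⟨a, b, h1, h2, h3, h⟩ := exists_chebDiff_eq (k := k)
    (F := fun j t => (k + 1).descFactorial j * max (t - x) 0 ^ (k + 1 - j)) (fun j hj t => by
      obtain ⟨r, rfl⟩ : ∃ r, k = j + r + 1 := ⟨k - j - 1, by omega⟩
      have e1 : j + r + 1 + 1 - j = r + 2 := by omega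
      have e2 : j + r + 1 + 1 - (j + 1) = r + 1 := by omega
      rw [e1, e2, Nat.descFactorial_succ, e1]
      have := ((hasDerivAt_posPart_pow r (t - x)).comp t
        ((hasDerivAt_id t).sub_const x)).const_mul (((j + r + 1 + 1).descFactorial j : ℕ) : ℝ)
      refine this.congr_deriv ?_
      push_cast
      ring)
  refine ⟨a, b, h1, h2, h3, ?_⟩
  have hf : (k + 1).descFactorial k = (k + 1).factorial := by
    have := Nat.factorial_mul_descFactorial (n := k + 1) (k := k) (by omega)
    simpa using this
  have hpos : ((k + 1).factorial : ℝ) ≠ 0 := by positivity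
  simp only [Nat.descFactorial_zero, Nat.cast_one, one_mul, Nat.sub_zero, hf,
    Nat.add_sub_cancel_left, pow_one] at h
  rw [chebSpline_zero]
  apply mul_left_cancel₀ hpos
  linear_combination h

lemma chebSpline_zero_mem_Icc (k : ℕ) (x : ℝ) : chebSpline k 0 x ∈ Set.Icc 0 1 := by
  obtain ⟨a, b, -, hab, -, h⟩ := exists_chebSpline_mul_eq k x
  have h1 : max (a - x) 0 ≤ max (b - x) 0 := by gcongr
  have h2 : max (b - x) 0 ≤ max (a - x) 0 + (b - a) :=
    max_le (by linarith [le_max_left (a - x) 0]) (by linarith [le_max_right (a - x) 0])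
  constructor <;> nlinarith

lemma chebSpline_zero_of_le (k : ℕ) {x : ℝ} (hx : x ≤ -1) : chebSpline k 0 x = 1 := by
  obtain ⟨a, b, ha, hab, -, h⟩ := exists_chebSpline_mul_eq k x
  rw [max_eq_left (by linarith), max_eq_left (by linarith)] at h
  have : b - a ≠ 0 := by linarith
  apply mul_right_cancel₀ this
  linarith

lemma chebSpline_zero_of_ge (k : ℕ) {x : ℝ} (hx : 1 ≤ x) : chebSpline k 0 x = 0 := by
  obtain ⟨a, b, ha, hab, hb, h⟩ := exists_chebSpline_mul_eq k x
  rw [max_eq_right (by linarith), max_eq_right (by linarith), sub_self] at h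
  exact (mul_eq_zero.1 h).resolve_right (by linarith)

end Spline

section SplineBounds

open Polynomial Polynomial.Chebyshev

lemma node_reflect {n i : ℕ} (hn : n ≠ 0) (hi : i ≤ n) : node n (n - i) = - node n i := by
  have hn' : (n : ℝ) ≠ 0 := Nat.cast_ne_zero.2 hn
  rw [node, node, ← cos_pi_sub, Nat.cast_sub hi]
  congr 1
  field_simp

lemma chebDiff_comp_neg (k : ℕ) (f : ℝ → ℝ) :
    chebDiff k (fun t => f (-t)) = (-1) ^ (k + 1) * chebDiff k f := by
  rw [chebDiff, chebDiff, ← Finset.sum_range_reflect, mul_left_comm]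
  congr 1
  rw [Finset.mul_sum]
  refine Finset.sum_congr rfl fun i hi => ?_
  have hi' : i ≤ k + 1 := by simpa [Nat.lt_succ_iff] using hi
  have e : k + 2 - 1 - i = k + 1 - i := by omega
  have h1 : endpointFactor (k + 1) (k + 1 - i) = endpointFactor (k + 1) i := by
    rw [endpointFactor, endpointFactor]
    congr 1
    grind
  have h2 : (-1 : ℝ) ^ (k + 1 - i) = (-1) ^ (k + 1) * (-1) ^ i := by
    obtain ⟨l, hl⟩ := Nat.exists_eq_add_of_le hi'
    rw [hl, Nat.add_sub_cancel_left, pow_add, mul_right_comm, ← mul_pow]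
    simp
  rw [e, h1, h2, node_reflect (by omega) hi', neg_neg]
  ring

lemma chebSpline_zero_add_neg (k : ℕ) (x : ℝ) :
    chebSpline k 0 x + chebSpline k 0 (-x) = 1 := by
  have hP : ((X - C x) ^ (k + 1) : ℝ[X]).natDegree = k + 1 := by
    rw [natDegree_pow, natDegree_X_sub_C, mul_one]
  have hm : ((X - C x) ^ (k + 1) : ℝ[X]).Monic := (monic_X_sub_C x).pow _
  have h1 := chebDiff_eval (k := k) (P := (X - C x) ^ (k + 1))
    (by rw [degree_eq_natDegree hm.ne_zero, hP])
  have h2 : ((X - C x) ^ (k + 1) : ℝ[X]).coeff (k + 1) = 1 := by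
    have := hm.coeff_natDegree
    rwa [hP] at this
  rw [h2] at h1
  have h3 := chebDiff_comp_neg k (fun t => max (x - t) 0 ^ (k + 1))
  have h4 : (fun t : ℝ => max (x - -t) 0 ^ (k + 1)) = fun t => max (t - -x) 0 ^ (k + 1) := by
    ext t; rw [show x - -t = t - -x by ring]
  rw [h4] at h3
  rw [chebSpline_zero, chebSpline_zero, h3]
  refine Eq.trans ?_ h1
  rw [chebDiff, chebDiff, chebDiff, mul_left_comm, ← mul_add, Finset.mul_sum, ← Finset.sum_add_distrib]
  congr 1
  refine Finset.sum_congr rfl fun i _ => ?_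
  set t := node (k + 1) i
  have : max (t - x) 0 ^ (k + 1) + (-1) ^ (k + 1) * max (x - t) 0 ^ (k + 1)
      = (t - x) ^ (k + 1) := by
    rcases le_total t x with h | h
    · rw [max_eq_right (by linarith), max_eq_left (by linarith), ← mul_pow]
      simp
    · rw [max_eq_left (by linarith), max_eq_right (by linarith)]
      simp
  simp only [eval_pow, eval_sub, eval_X, eval_C]
  rw [← this]
  ring

lemma sum_endpointFactor (k : ℕ) (u : ℕ → ℝ) :
    ∑ i ∈ Finset.range (k + 2), (-1) ^ i * endpointFactor (k + 1) i * u i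
      = 1 / 2 * ∑ i ∈ Finset.range (k + 1), (-1) ^ i * (u i - u (i + 1)) := by
  rw [Finset.sum_range_succ, Finset.sum_range_succ']
  have h : ∀ i ∈ Finset.range k, endpointFactor (k + 1) (i + 1) = 1 := fun i hi => by
    have := Finset.mem_range.1 hi
    rw [endpointFactor, if_neg (by omega)]
  rw [Finset.sum_congr rfl fun i hi => by rw [h i hi, mul_one]]
  simp only [mul_sub, Finset.sum_sub_distrib]
  rw [Finset.sum_range_succ', Finset.sum_range_succ (fun i => (-1) ^ i * u (i + 1))]
  have h2 : ∑ i ∈ Finset.range k, (-1 : ℝ) ^ (i + 1) * u (i + 1)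
      = - ∑ i ∈ Finset.range k, (-1) ^ i * u (i + 1) := by
    rw [← Finset.sum_neg_distrib]
    exact Finset.sum_congr rfl fun i _ => by ring
  rw [h2]
  simp [endpointFactor]
  ring

lemma Mc_succ (k : ℕ) : Mc (k + 1) = 2 ^ k * k.factorial / 2 := by
  rw [Mc, show (((k + 1 : ℕ) : ℤ) - 2) = (k : ℤ) - 1 by push_cast; ring,
    zpow_sub₀ (by norm_num)]
  simp
  ring

lemma half_le_Mc_succ (k : ℕ) : 1 / 2 ≤ Mc (k + 1) := by
  rw [Mc_succ]
  have h1 : (1 : ℝ) ≤ 2 ^ k := one_le_pow₀ (by norm_num)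
  have h2 : (1 : ℝ) ≤ k.factorial := by exact_mod_cast Nat.factorial_pos k
  nlinarith

lemma abs_chebSpline_top_sub_le (k : ℕ) (x y : ℝ) :
    |chebSpline k k x - chebSpline k k y| ≤ Mc (k + 1) * |x - y| := by
  wlog hxy : x ≤ y generalizing x y
  · rw [abs_sub_comm, abs_sub_comm x]
    exact this y x (le_of_not_ge hxy)
  have hf : (k + 1).descFactorial k = (k + 1).factorial := by
    have := Nat.factorial_mul_descFactorial (n := k + 1) (k := k) (by omega)
    simpa using this
  set δ : ℕ → ℝ := fun i => max (node (k + 1) i - x) 0 - max (node (k + 1) i - y) 0 with hδ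
  have hanti : ∀ i < k + 1, 0 ≤ δ i - δ (i + 1) := fun i hi => by
    have : node (k + 1) (i + 1) < node (k + 1) i := node_lt (by omega) (by omega)
    simp only [hδ]
    grind
  have e : chebSpline k k x - chebSpline k k y
      = (-1) ^ k * Mc (k + 1) * ∑ i ∈ Finset.range (k + 1), (-1) ^ i * (δ i - δ (i + 1)) := by
    have hs : ∑ i ∈ Finset.range (k + 2), (-1) ^ i * endpointFactor (k + 1) i * δ i
        = (∑ i ∈ Finset.range (k + 2), (-1) ^ i * endpointFactor (k + 1) i *
            max (node (k + 1) i - x) 0) -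
          ∑ i ∈ Finset.range (k + 2), (-1) ^ i * endpointFactor (k + 1) i *
            max (node (k + 1) i - y) 0 := by
      rw [← Finset.sum_sub_distrib]
      exact Finset.sum_congr rfl fun i _ => by simp only [hδ]; ring
    have hs' := (sum_endpointFactor k δ).symm.trans hs
    rw [chebSpline, chebSpline, chebDiff, chebDiff, hf, Mc_succ, Nat.factorial_succ]
    simp only [Nat.add_sub_cancel_left, pow_one]
    have hk : (k : ℝ) + 1 ≠ 0 := by positivity
    push_cast
    field_simp
    linear_combination (-2) * hs'
  have hM : 0 ≤ Mc (k + 1) := by linarith [half_le_Mc_succ k]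
  rw [e, abs_mul, abs_mul, abs_neg_one_pow, one_mul, abs_of_nonneg hM]
  refine mul_le_mul_of_nonneg_left ?_ hM
  calc |∑ i ∈ Finset.range (k + 1), (-1) ^ i * (δ i - δ (i + 1))|
      ≤ ∑ i ∈ Finset.range (k + 1), |(-1) ^ i * (δ i - δ (i + 1))| :=
        Finset.abs_sum_le_sum_abs _ _
    _ = ∑ i ∈ Finset.range (k + 1), (δ i - δ (i + 1)) :=
        Finset.sum_congr rfl fun i hi => by
          rw [abs_mul, abs_neg_one_pow, one_mul,
            abs_of_nonneg (hanti i (Finset.mem_range.1 hi))]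
    _ = δ 0 - δ (k + 1) := Finset.sum_range_sub' δ (k + 1)
    _ ≤ |x - y| := by
        rw [abs_of_nonpos (by linarith)]
        simp only [hδ]
        grind

lemma chebSpline_eq_zero {k j : ℕ} (hj0 : j ≠ 0) (hjk : j ≤ k) {x : ℝ} (hx : 1 < |x|) :
    chebSpline k j x = 0 := by
  obtain ⟨j, rfl⟩ := Nat.exists_eq_succ_of_ne_zero hj0
  have hopen : {y : ℝ | 1 < |y|} ∈ nhds x :=
    (isOpen_lt continuous_const continuous_abs).mem_nhds hx
  induction j generalizing x with
  | zero =>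
    rcases lt_abs.1 hx with h | h
    · refine (hasDerivAt_chebSpline (by omega) x).unique
        ((hasDerivAt_const x (0 : ℝ)).congr_of_eventuallyEq ?_)
      filter_upwards [Ioi_mem_nhds h] with y hy using chebSpline_zero_of_ge k (le_of_lt hy)
    · refine (hasDerivAt_chebSpline (by omega) x).unique
        ((hasDerivAt_const x (1 : ℝ)).congr_of_eventuallyEq ?_)
      filter_upwards [Iio_mem_nhds (show x < -1 by linarith)] with y hy
        using chebSpline_zero_of_le k (le_of_lt hy)
  | succ j ih =>
    refine (hasDerivAt_chebSpline (by omega) x).unique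
      ((hasDerivAt_const x (0 : ℝ)).congr_of_eventuallyEq ?_)
    filter_upwards [hopen] with y hy
    have hy' : {y : ℝ | 1 < |y|} ∈ nhds y := (isOpen_lt continuous_const continuous_abs).mem_nhds hy
    apply ih <;> omega

lemma abs_le_of_lipschitz_of_eq_zero {f : ℝ → ℝ} {M : ℝ} (hM : 0 ≤ M)
    (hL : ∀ x y, |f x - f y| ≤ M * |x - y|) (h0 : ∀ x, 1 < |x| → f x = 0) (x : ℝ) :
    |f x| ≤ M := by
  by_cases hx : 1 < |x|
  · rw [h0 x hx, abs_zero]; exact hM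
  have hx' := abs_le.1 (not_lt.1 hx)
  have key : ∀ η > 0, |f x| ≤ M * (1 + η) := fun η hη => by
    rcases le_total x 0 with h | h
    · have := hL x (-1 - η)
      rw [h0 (-1 - η) (by rw [abs_of_neg] <;> linarith), sub_zero,
        abs_of_nonneg (show 0 ≤ x - (-1 - η) by linarith [hx'.1])] at this
      exact this.trans (by gcongr; linarith)
    · have := hL x (1 + η)
      rw [h0 (1 + η) (by rw [abs_of_pos] <;> linarith), sub_zero,
        abs_of_nonpos (show x - (1 + η) ≤ 0 by linarith [hx'.2])] at this
      exact this.trans (by gcongr; linarith)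
  have hlim : Filter.Tendsto (fun η : ℝ => M * (1 + η)) (nhdsWithin 0 (Set.Ioi 0))
      (nhds (M * (1 + 0))) := by
    apply Filter.Tendsto.mono_left _ nhdsWithin_le_nhds
    exact (continuous_const.mul (continuous_const.add continuous_id)).tendsto 0
  rw [add_zero, mul_one] at hlim
  exact ge_of_tendsto hlim (by filter_upwards [self_mem_nhdsWithin] with η hη using key η hη)

lemma chebSpline_lipschitz {k j : ℕ} (hj0 : j ≠ 0) (hjk : j ≤ k) (x y : ℝ) :
    |chebSpline k j x - chebSpline k j y| ≤ Mc (k + 1) * |x - y| := by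
  have hM : 0 ≤ Mc (k + 1) := by linarith [half_le_Mc_succ k]
  induction hjk using Nat.decreasingInduction generalizing x y with
  | self => exact abs_chebSpline_top_sub_le k x y
  | of_succ j hj ih =>
    have := Convex.norm_image_sub_le_of_norm_hasDerivWithin_le (s := Set.univ) (x := y) (y := x)
      (C := Mc (k + 1))
      (fun z _ => (hasDerivAt_chebSpline hj z).hasDerivWithinAt)
      (fun z _ => abs_le_of_lipschitz_of_eq_zero hM (ih (by omega))
        (fun w hw => chebSpline_eq_zero (by omega) (by omega) hw) z)
      convex_univ (Set.mem_univ _) (Set.mem_univ _)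
    exact this

lemma abs_chebSpline_le {k j : ℕ} (hj0 : j ≠ 0) (hjk : j ≤ k) (x : ℝ) :
    |chebSpline k j x| ≤ Mc (k + 1) :=
  abs_le_of_lipschitz_of_eq_zero (by linarith [half_le_Mc_succ k])
    (chebSpline_lipschitz hj0 hjk) (fun _ hw => chebSpline_eq_zero hj0 hjk hw) x

lemma continuous_chebSpline_zero (k : ℕ) : Continuous (chebSpline k 0) := by
  unfold chebSpline chebDiff
  fun_prop

end SplineBounds

section SmoothingInequality

open Set

/-- The spline `chebSpline k 0` rescaled to descend from `1` to `0` on `[c - δ, c + δ]`. -/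
noncomputable def smoothStep (k : ℕ) (c δ x : ℝ) : ℝ := chebSpline k 0 ((x - c) / δ)

lemma continuous_smoothStep (k : ℕ) (c δ : ℝ) : Continuous (smoothStep k c δ) := by
  unfold smoothStep
  exact (continuous_chebSpline_zero k).comp (by fun_prop)

lemma smoothStep_mem_Icc (k : ℕ) (c δ x : ℝ) : smoothStep k c δ x ∈ Icc 0 1 :=
  chebSpline_zero_mem_Icc k _

lemma smoothStep_of_le (k : ℕ) {c δ x : ℝ} (hδ : 0 < δ) (hx : x ≤ c - δ) :
    smoothStep k c δ x = 1 :=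
  chebSpline_zero_of_le k (by rw [div_le_iff₀ hδ]; linarith)

lemma smoothStep_of_ge (k : ℕ) {c δ x : ℝ} (hδ : 0 < δ) (hx : c + δ ≤ x) :
    smoothStep k c δ x = 0 :=
  chebSpline_zero_of_ge k (by rw [le_div_iff₀ hδ]; linarith)

lemma integrable_smoothStep (k : ℕ) (c δ : ℝ) (μ : Measure ℝ) [IsFiniteMeasure μ] :
    Integrable (smoothStep k c δ) μ :=
  Integrable.of_bound (continuous_smoothStep k c δ).aestronglyMeasurable 1
    (Filter.Eventually.of_forall fun x => by
      have := smoothStep_mem_Icc k c δ x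
      rw [Real.norm_eq_abs, abs_of_nonneg this.1]; exact this.2)

lemma integral_smoothStep (k : ℕ) (c : ℝ) (δ : ℝ) :
    ∫ x in (c - δ)..(c + δ), smoothStep k c δ x = δ := by
  have h1 := intervalIntegral.integral_comp_sub_left (a := c - δ) (b := c + δ)
    (smoothStep k c δ) (2 * c)
  rw [show 2 * c - (c + δ) = c - δ by ring, show 2 * c - (c - δ) = c + δ by ring] at h1
  have h2 : ∀ x, smoothStep k c δ (2 * c - x) = 1 - smoothStep k c δ x := fun x => by
    rw [smoothStep, smoothStep, show (2 * c - x - c) / δ = - ((x - c) / δ) by ring]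
    linarith [chebSpline_zero_add_neg k ((x - c) / δ)]
  simp only [h2] at h1
  rw [intervalIntegral.integral_sub (by simp)
    ((continuous_smoothStep k c δ).intervalIntegrable _ _)] at h1
  simp at h1
  linarith

lemma measureReal_Iic_le_integral_smoothStep (k : ℕ) {c δ : ℝ} (hδ : 0 < δ) (μ : Measure ℝ)
    [IsFiniteMeasure μ] : μ.real (Iic (c - δ)) ≤ ∫ x, smoothStep k c δ x ∂μ := by
  rw [← integral_indicator_one measurableSet_Iic]
  refine integral_mono ((integrable_const (1 : ℝ)).indicator measurableSet_Iic)
    (integrable_smoothStep k c δ μ) fun x => ?_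
  by_cases hx : x ≤ c - δ
  · rw [indicator_of_mem (mem_Iic.2 hx), smoothStep_of_le k hδ hx]; rfl
  · rw [indicator_of_notMem (by simpa using hx)]
    exact (smoothStep_mem_Icc k c δ x).1

lemma integral_smoothStep_le_measureReal_Iic (k : ℕ) {c δ : ℝ} (hδ : 0 < δ) (μ : Measure ℝ)
    [IsFiniteMeasure μ] : ∫ x, smoothStep k c δ x ∂μ ≤ μ.real (Iic (c + δ)) := by
  rw [← integral_indicator_one measurableSet_Iic]
  refine integral_mono (integrable_smoothStep k c δ μ)
    ((integrable_const (1 : ℝ)).indicator measurableSet_Iic) fun x => ?_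
  by_cases hx : x ≤ c + δ
  · rw [indicator_of_mem (mem_Iic.2 hx)]; exact (smoothStep_mem_Icc k c δ x).2
  · rw [indicator_of_notMem (by simpa using hx), smoothStep_of_ge k hδ (not_le.1 hx).le]

lemma setIntegral_Ioc_le_of_le_smul_volume {ν : Measure ℝ} {A : ℝ} (hA : 0 ≤ A)
    (hν : ν ≤ ENNReal.ofReal A • volume) {f : ℝ → ℝ} (hf : Continuous f) (hf0 : ∀ x, 0 ≤ f x)
    {a b : ℝ} (hab : a ≤ b) : ∫ x in Ioc a b, f x ∂ν ≤ A * ∫ x in a..b, f x := by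
  have hint : Integrable f (volume.restrict (Ioc a b)) :=
    (hf.integrableOn_Icc (a := a) (b := b)).mono_set Ioc_subset_Icc_self
  calc ∫ x in Ioc a b, f x ∂ν
      ≤ ∫ x, f x ∂(ENNReal.ofReal A • volume.restrict (Ioc a b)) := by
        refine integral_mono_measure ?_ (Filter.Eventually.of_forall hf0)
          (hint.smul_measure ENNReal.ofReal_ne_top)
        rw [← Measure.restrict_smul]
        exact Measure.restrict_mono le_rfl hν
    _ = A * ∫ x in a..b, f x := by
        rw [integral_smul_measure, ENNReal.toReal_ofReal hA,
          intervalIntegral.integral_of_le hab, smul_eq_mul]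

lemma integral_smoothStep_eq (k : ℕ) {c δ : ℝ} (hδ : 0 < δ) (ν : Measure ℝ)
    [IsFiniteMeasure ν] : ∫ x, smoothStep k c δ x ∂ν
      = ν.real (Iic (c - δ)) + ∫ x in Ioc (c - δ) (c + δ), smoothStep k c δ x ∂ν := by
  have hi := integrable_smoothStep k c δ ν
  have h0 : ∫ x in Ioi (c + δ), smoothStep k c δ x ∂ν = 0 :=
    setIntegral_eq_zero_of_forall_eq_zero fun x hx => smoothStep_of_ge k hδ (le_of_lt hx)
  have h1 : ∫ x in Iic (c - δ), smoothStep k c δ x ∂ν = ν.real (Iic (c - δ)) := by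
    rw [setIntegral_congr_fun measurableSet_Iic fun x hx => smoothStep_of_le k hδ hx]
    simp
  rw [← integral_add_compl (measurableSet_Iic (a := c + δ)) hi, compl_Iic, h0, add_zero,
    ← Iic_union_Ioc_eq_Iic (show c - δ ≤ c + δ by linarith),
    setIntegral_union (Iic_disjoint_Ioc le_rfl) measurableSet_Ioc hi.integrableOn
      hi.integrableOn, h1]

lemma measureReal_Iic_eq (c δ : ℝ) (hδ : 0 < δ) (ν : Measure ℝ) [IsFiniteMeasure ν] :
    ν.real (Iic (c + δ)) = ν.real (Iic (c - δ)) + ν.real (Ioc (c - δ) (c + δ)) := by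
  rw [← Iic_union_Ioc_eq_Iic (show c - δ ≤ c + δ by linarith),
    measureReal_union (Iic_disjoint_Ioc le_rfl) measurableSet_Ioc]

lemma integral_smoothStep_le_add (k : ℕ) {c δ A : ℝ} (hδ : 0 < δ) (hA : 0 ≤ A)
    (ν : Measure ℝ) [IsFiniteMeasure ν] (hν : ν ≤ ENNReal.ofReal A • volume) :
    ∫ x, smoothStep k c δ x ∂ν ≤ ν.real (Iic (c - δ)) + A * δ := by
  have := setIntegral_Ioc_le_of_le_smul_volume hA hν (continuous_smoothStep k c δ)
    (fun x => (smoothStep_mem_Icc k c δ x).1) (show c - δ ≤ c + δ by linarith)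
  rw [integral_smoothStep] at this
  rw [integral_smoothStep_eq k hδ]
  linarith

lemma measureReal_Iic_sub_le_integral_smoothStep (k : ℕ) {c δ A : ℝ} (hδ : 0 < δ) (hA : 0 ≤ A)
    (ν : Measure ℝ) [IsFiniteMeasure ν] (hν : ν ≤ ENNReal.ofReal A • volume) :
    ν.real (Iic (c + δ)) - A * δ ≤ ∫ x, smoothStep k c δ x ∂ν := by
  have h := setIntegral_Ioc_le_of_le_smul_volume hA hν
    (f := fun x => 1 - smoothStep k c δ x)
    (continuous_const.sub (continuous_smoothStep k c δ)) (fun x => sub_nonneg.2 (smoothStep_mem_Icc k c δ x).2) (show c - δ ≤ c + δ by linarith)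
  rw [integral_sub (integrable_const _) (integrable_smoothStep k c δ _),
    intervalIntegral.integral_sub (by simp)
      ((continuous_smoothStep k c δ).intervalIntegrable _ _), integral_smoothStep] at h
  simp only [integral_const, intervalIntegral.integral_const, smul_eq_mul, mul_one,
    measureReal_restrict_apply_univ] at h
  rw [integral_smoothStep_eq k hδ, measureReal_Iic_eq c δ hδ]
  nlinarith

lemma bddAbove_dSm (m : ℕ) (μ ν : Measure ℝ) [IsProbabilityMeasure μ] [IsProbabilityMeasure ν] :
    BddAbove (range fun h : {h : ℝ → ℝ // testFun m h} =>
      |(∫ x, h.1 x ∂μ) - ∫ x, h.1 x ∂ν|) := by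
  refine ⟨2, ?_⟩
  rintro _ ⟨⟨h, -, h0, -⟩, rfl⟩
  have hb : ∀ x, ‖h x‖ ≤ 1 := fun x => by simpa using h0 0 (Nat.zero_le _) x
  have key : ∀ ρ : Measure ℝ, IsProbabilityMeasure ρ → |∫ x, h x ∂ρ| ≤ 1 := fun ρ _ => by
    simpa using norm_integral_le_of_norm_le_const (μ := ρ) (Filter.Eventually.of_forall hb)
  have h1 := abs_le.1 (key μ inferInstance)
  have h2 := abs_le.1 (key ν inferInstance)
  exact abs_le.2 ⟨by linarith, by linarith⟩

lemma dSm_nonneg (m : ℕ) (μ ν : Measure ℝ) : 0 ≤ dSm m μ ν :=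
  Real.iSup_nonneg fun _ => abs_nonneg _

/-- The successive derivatives of a centred, normalised `smoothStep`. -/
noncomputable def stepFamily (k : ℕ) (c δ N : ℝ) (j : ℕ) (x : ℝ) : ℝ :=
  N⁻¹ * δ⁻¹ ^ j * (chebSpline k j ((x - c) / δ) - if j = 0 then 1 / 2 else 0)

lemma hasDerivAt_stepFamily {k j : ℕ} (c δ N : ℝ) (hj : j < k) (x : ℝ) :
    HasDerivAt (stepFamily k c δ N j) (stepFamily k c δ N (j + 1) x) x := by
  have h1 : HasDerivAt (fun x : ℝ => (x - c) / δ) (1 / δ) x :=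
    ((hasDerivAt_id x).sub_const c).div_const δ
  have h2 := (((hasDerivAt_chebSpline hj ((x - c) / δ)).comp x h1).sub_const
    (if j = 0 then 1 / 2 else 0)).const_mul (N⁻¹ * δ⁻¹ ^ j)
  refine h2.congr_deriv ?_
  rw [stepFamily, if_neg j.succ_ne_zero]
  ring

lemma inv_pow_le_one_add {δ : ℝ} (hδ : 0 < δ) {j m : ℕ} (hj : j ≤ m) :
    δ⁻¹ ^ j ≤ 1 + δ⁻¹ ^ m := by
  have h0 : 0 < δ⁻¹ := inv_pos.2 hδ
  rcases le_total δ⁻¹ 1 with h | h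
  · linarith [pow_le_one₀ (n := j) h0.le h, pow_pos h0 m]
  · linarith [pow_le_pow_right₀ h hj]

lemma testFun_stepFamily (k : ℕ) (c : ℝ) {δ : ℝ} (hδ : 0 < δ) :
    testFun (k + 1) (stepFamily k c δ (Mc (k + 1) * (1 + δ⁻¹ ^ (k + 1))) 0) := by
  set N := Mc (k + 1) * (1 + δ⁻¹ ^ (k + 1)) with hN
  have hM := half_le_Mc_succ k
  have hd : 0 < δ⁻¹ := inv_pos.2 hδ
  have hNpos : 0 < N := by positivity
  have hF : ∀ j < k, ∀ x, HasDerivAt (stepFamily k c δ N j) (stepFamily k c δ N (j + 1) x) x :=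
    fun j hj x => hasDerivAt_stepFamily c δ N hj x
  have hlip : ∀ x y, |stepFamily k c δ N k x - stepFamily k c δ N k y| ≤ |x - y| :=
    fun x y => by
      have e : stepFamily k c δ N k x - stepFamily k c δ N k y = N⁻¹ * δ⁻¹ ^ k *
          (chebSpline k k ((x - c) / δ) - chebSpline k k ((y - c) / δ)) := by
        rw [stepFamily, stepFamily]; ring
      have h := abs_chebSpline_top_sub_le k ((x - c) / δ) ((y - c) / δ)
      rw [show (x - c) / δ - (y - c) / δ = δ⁻¹ * (x - y) by ring, abs_mul, abs_of_pos hd] at h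
      rw [e, abs_mul, abs_of_pos (by positivity)]
      calc N⁻¹ * δ⁻¹ ^ k * |chebSpline k k ((x - c) / δ) - chebSpline k k ((y - c) / δ)|
          ≤ N⁻¹ * δ⁻¹ ^ k * (Mc (k + 1) * (δ⁻¹ * |x - y|)) := by gcongr
        _ = N⁻¹ * (Mc (k + 1) * δ⁻¹ ^ (k + 1)) * |x - y| := by ring
        _ ≤ N⁻¹ * N * |x - y| := by
            gcongr
            rw [hN]
            gcongr
            linarith
        _ = |x - y| := by rw [inv_mul_cancel₀ hNpos.ne', one_mul]
  have hLip : LipschitzWith 1 (stepFamily k c δ N k) :=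
    LipschitzWith.of_dist_le_mul fun x y => by
      simpa [Real.dist_eq] using hlip x y
  refine ⟨contDiff_of_family hF hLip.continuous, fun j hj x => ?_, ?_⟩
  · rw [Nat.add_sub_cancel] at hj
    rw [iteratedDeriv_of_family hF hj]
    have hb : |chebSpline k j ((x - c) / δ) - if j = 0 then 1 / 2 else 0| ≤ Mc (k + 1) := by
      split_ifs with h
      · subst h
        have := chebSpline_zero_mem_Icc k ((x - c) / δ)
        exact abs_le.2 ⟨by linarith [this.1], by linarith [this.2]⟩
      · rw [sub_zero]; exact abs_chebSpline_le h hj _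
    rw [stepFamily, abs_mul, abs_of_pos (by positivity)]
    calc _ ≤ N⁻¹ * (1 + δ⁻¹ ^ (k + 1)) * Mc (k + 1) := by
          gcongr
          exact inv_pow_le_one_add hδ (by omega)
      _ = N⁻¹ * N := by rw [hN]; ring
      _ = 1 := inv_mul_cancel₀ hNpos.ne'
  · rw [Nat.add_sub_cancel, iteratedDeriv_of_family hF le_rfl]
    exact hLip

lemma abs_integral_smoothStep_sub_le (k : ℕ) (c : ℝ) {δ : ℝ} (hδ : 0 < δ) (μ ν : Measure ℝ)
    [IsProbabilityMeasure μ] [IsProbabilityMeasure ν] :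
    |(∫ x, smoothStep k c δ x ∂μ) - ∫ x, smoothStep k c δ x ∂ν|
      ≤ Mc (k + 1) * (1 + δ⁻¹ ^ (k + 1)) * dSm (k + 1) μ ν := by
  set N := Mc (k + 1) * (1 + δ⁻¹ ^ (k + 1)) with hN
  have hM := half_le_Mc_succ k
  have hNpos : 0 < N := by positivity
  have h := le_ciSup (bddAbove_dSm (k + 1) μ ν) ⟨_, testFun_stepFamily k c hδ⟩
  have e : ∀ ρ : Measure ℝ, IsProbabilityMeasure ρ →
      ∫ x, stepFamily k c δ N 0 x ∂ρ = N⁻¹ * ((∫ x, smoothStep k c δ x ∂ρ) - 1 / 2) :=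
    fun ρ _ => by
      have : ∀ x, stepFamily k c δ N 0 x = N⁻¹ * (smoothStep k c δ x - 1 / 2) := fun x => by
        simp [stepFamily, smoothStep]
      simp only [this]
      rw [integral_const_mul, integral_sub (integrable_smoothStep k c δ ρ) (integrable_const _)]
      simp
  change |(∫ x, stepFamily k c δ N 0 x ∂μ) - ∫ x, stepFamily k c δ N 0 x ∂ν|
    ≤ dSm (k + 1) μ ν at h
  rw [e μ inferInstance, e ν inferInstance, ← mul_sub, sub_sub_sub_cancel_right, abs_mul,
    abs_of_pos (inv_pos.2 hNpos), inv_mul_le_iff₀ hNpos] at h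
  exact h

lemma abs_measureReal_Iic_sub_le (k : ℕ) {A δ : ℝ} (hδ : 0 < δ) (hA : 0 ≤ A) (μ ν : Measure ℝ)
    [IsProbabilityMeasure μ] [IsProbabilityMeasure ν] (hν : ν ≤ ENNReal.ofReal A • volume)
    (z : ℝ) : |μ.real (Iic z) - ν.real (Iic z)|
      ≤ A * δ + Mc (k + 1) * (1 + δ⁻¹ ^ (k + 1)) * dSm (k + 1) μ ν := by
  have a1 := abs_le.1 (abs_integral_smoothStep_sub_le k (z + δ) hδ μ ν)
  have a2 := measureReal_Iic_le_integral_smoothStep k (c := z + δ) hδ μ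
  have a3 := integral_smoothStep_le_add k (c := z + δ) hδ hA ν hν
  have b1 := abs_le.1 (abs_integral_smoothStep_sub_le k (z - δ) hδ μ ν)
  have b2 := integral_smoothStep_le_measureReal_Iic k (c := z - δ) hδ μ
  have b3 := measureReal_Iic_sub_le_integral_smoothStep k (c := z - δ) hδ hA ν hν
  rw [add_sub_cancel_right] at a2 a3
  rw [sub_add_cancel] at b2 b3
  exact abs_le.2 ⟨by linarith [b1.1], by linarith [a1.2]⟩

lemma withDensity_ofReal_le_smul {A : ℝ} {p : ℝ → ℝ} (hbd : ∀ y, p y ≤ A) (ρ : Measure ℝ) :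
    ρ.withDensity (fun y => ENNReal.ofReal (p y)) ≤ ENNReal.ofReal A • ρ := by
  rw [← withDensity_const]
  exact withDensity_mono (Filter.Eventually.of_forall fun y => ENNReal.ofReal_le_ofReal (hbd y))

end SmoothingInequality

theorem kolmogorov_le_of_bounded_density'
    (m : ℕ) (hm : 1 ≤ m) (A : ℝ) (hA : 0 < A)
    (μ ν : Measure ℝ) [IsProbabilityMeasure μ] [IsProbabilityMeasure ν]
    (p : ℝ → ℝ) (hp0 : ∀ x, 0 ≤ p x)
    (hpdf : ν = volume.withDensity (fun y => ENNReal.ofReal (p y)))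
    (hbd : ∀ y, p y ≤ A) :
    dKol μ ν ≤ 2 * (A ^ m * Mc m * dSm m μ ν) ^ ((1 : ℝ) / (m + 1)) + Mc m * dSm m μ ν := by
  obtain ⟨k, rfl⟩ := Nat.exists_eq_add_of_le' hm
  have hν : ν ≤ ENNReal.ofReal A • volume := hpdf ▸ withDensity_ofReal_le_smul hbd volume
  have hM := half_le_Mc_succ k
  refine ciSup_le fun z => ?_
  have key : ∀ δ > 0, |μ.real (Set.Iic z) - ν.real (Set.Iic z)|
      ≤ A * δ + Mc (k + 1) * (1 + δ⁻¹ ^ (k + 1)) * dSm (k + 1) μ ν :=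
    fun δ hδ => abs_measureReal_Iic_sub_le k hδ hA.le μ ν hν z
  change |μ.real (Set.Iic z) - ν.real (Set.Iic z)| ≤ _
  rcases (dSm_nonneg (k + 1) μ ν).eq_or_lt with h0 | hd
  · rw [← h0] at key ⊢
    have hexp : (1 : ℝ) / ((k + 1 : ℕ) + 1) ≠ 0 := by positivity
    simp only [mul_zero, add_zero, Real.zero_rpow hexp] at key ⊢
    refine le_of_forall_pos_le_add fun ε hε => ?_
    have := key (ε / A) (by positivity)
    rwa [mul_div_cancel₀ _ hA.ne', ← zero_add ε] at this
  · set d := dSm (k + 1) μ ν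
    set M := Mc (k + 1)
    have hB : 0 < A ^ (k + 1) * M * d := by positivity
    set R := (A ^ (k + 1) * M * d) ^ ((1 : ℝ) / ((k + 1 : ℕ) + 1)) with hR
    have hRpos : 0 < R := Real.rpow_pos_of_pos hB _
    have hpow : R ^ (k + 1 + 1) = A ^ (k + 1) * M * d := by
      have := Real.rpow_inv_natCast_pow hB.le (n := k + 1 + 1) (by omega)
      rw [hR, one_div]
      exact_mod_cast this
    have h := key (R / A) (by positivity)
    have e : M * (R / A)⁻¹ ^ (k + 1) * d = R := by
      rw [inv_div, div_pow]
      field_simp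
      rw [← pow_succ, hpow]
      ring
    have e2 : A * (R / A) = R := by field_simp
    rw [e2] at h
    linarith
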